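/- For the delimited-control calculus λF_{S,v}: for every type S with free type variables among ᾱ, every type variable c, every type T, every sequence of types T̄ of the same length as ᾱ, and every sequence of reducibility candidates R̄ with R_i ∈ RC(T_i), the parametric reducibility candidates satisfy RED_{S[c:=T]}(ᾱ ↦ R̄) = RED_S(ᾱ, c ↦ R̄, RED_T(ᾱ ↦ R̄)). -/

import Mathlib

/-!
Language `λF_{S,v}`: explicitly typed System F extended with the
delimited-control operators shift (`S k.t`), reset (`⟨t⟩`) and throw
(`k ← t`, `⌈E⌉ ← t`), under call by value, in de Bruijn representation
(separate de Bruijn indices for term variables, continuation variables and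
type variables).
-/

namespace LambdaFShift

/-- Term types: `S ::= α | (S/T → U/V) | ∀α.(S,T,U)`.
In `∀α.(S,T,U)` the quantifier binds `α` in all three components. -/
inductive Ty : Type where
  | var : Nat → Ty
  | arrow : Ty → Ty → Ty → Ty → Ty
  | all : Ty → Ty → Ty → Ty

/-- Lifting of a renaming under a binder. -/
def liftRen (ρ : Nat → Nat) : Nat → Nat
  | 0 => 0
  | n+1 => ρ n + 1

/-- Renaming of type variables in a type. -/
def renTy (ρ : Nat → Nat) : Ty → Ty
  | .var n => .var (ρ n)
  | .arrow a b c d => .arrow (renTy ρ a) (renTy ρ b) (renTy ρ c) (renTy ρ d)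
  | .all a b c => .all (renTy (liftRen ρ) a) (renTy (liftRen ρ) b) (renTy (liftRen ρ) c)

/-- Lifting of a type substitution under a type binder. -/
def liftTySub (σ : Nat → Ty) : Nat → Ty
  | 0 => .var 0
  | n+1 => renTy Nat.succ (σ n)

/-- Simultaneous substitution of types for type variables in a type. -/
def subTy (σ : Nat → Ty) : Ty → Ty
  | .var n => σ n
  | .arrow a b c d => .arrow (subTy σ a) (subTy σ b) (subTy σ c) (subTy σ d)
  | .all a b c => .all (subTy (liftTySub σ) a) (subTy (liftTySub σ) b) (subTy (liftTySub σ) c)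

/-- `subTy0 U S` is `S[α₀ := U]`. -/
def subTy0 (U : Ty) (S : Ty) : Ty :=
  subTy (fun n => match n with | 0 => U | n+1 => .var n) S

/-- `subTyList Ts S` is `S[ᾱ := Ts]`. -/
def subTyList (Ts : List Ty) (S : Ty) : Ty :=
  subTy (fun n => Ts.getD n (.var n)) S

/-- `ScopedTy p S`: all free type variables of `S` are `< p`. -/
inductive ScopedTy : Nat → Ty → Prop where
  | var : ∀ {p n}, n < p → ScopedTy p (.var n)
  | arrow : ∀ {p a b c d}, ScopedTy p a → ScopedTy p b → ScopedTy p c → ScopedTy p d →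
      ScopedTy p (.arrow a b c d)
  | all : ∀ {p a b c}, ScopedTy (p+1) a → ScopedTy (p+1) b → ScopedTy (p+1) c →
      ScopedTy p (.all a b c)

/-- A closed type. -/
def ClosedTy (S : Ty) : Prop := ScopedTy 0 S

mutual
/-- Terms of `λF_{S,v}`: variables, `λx:S.t`, application, `Λα.t`, type
application, `S k.t` (shift), `⟨t⟩` (reset), `k ← t` and `⌈E⌉ ← t` (throw). -/
inductive Tm : Type where
  | var : Nat → Tm
  | lam : Ty → Tm → Tm
  | app : Tm → Tm → Tm
  | tlam : Tm → Tm
  | tapp : Tm → Ty → Tm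
  | shift : Tm → Tm
  | reset : Tm → Tm
  | throwVar : Nat → Tm → Tm
  | throwCtx : Ctx → Tm → Tm

/-- Call-by-value evaluation contexts, represented inside-out:
`[]`, `(λx:S.t)·E`, `E t`, `E S`, `⌈E₀⌉ ← E`. -/
inductive Ctx : Type where
  | hole : Ctx
  | lamApp : Ty → Tm → Ctx → Ctx
  | app : Ctx → Tm → Ctx
  | tapp : Ctx → Ty → Ctx
  | throw : Ctx → Ctx → Ctx
end

/-- Metacontexts: stacks of contexts, `F ::= • | E·F`. -/
abbrev MCtx : Type := List Ctx

/-- Plugging a term in a context. -/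
def plug : Tm → Ctx → Tm
  | t, .hole => t
  | t, .lamApp S b E => plug (.app (.lam S b) t) E
  | t, .app E u => plug (.app t u) E
  | t, .tapp E S => plug (.tapp t S) E
  | t, .throw E0 E => plug (.throwCtx E0 t) E

/-- Plugging a term in a metacontext:
`plugm t • = t` and `plugm t (E·F) = plugm ⟨E[t]⟩ F`.
In particular `plugm t (E::F)` is `F[⟨E[t]⟩]`. -/
def plugm : Tm → MCtx → Tm
  | t, [] => t
  | t, E :: F => plugm (.reset (plug t E)) F

/-- Values: λ-abstractions and Λ-abstractions. -/
inductive IsValue : Tm → Prop where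
  | lam : ∀ {S t}, IsValue (.lam S t)
  | tlam : ∀ {t}, IsValue (.tlam t)

/-- Plain terms: no subterm of the form `⌈E⌉ ← t`. -/
inductive Plain : Tm → Prop where
  | var : ∀ {n}, Plain (.var n)
  | lam : ∀ {S t}, Plain t → Plain (.lam S t)
  | app : ∀ {a b}, Plain a → Plain b → Plain (.app a b)
  | tlam : ∀ {t}, Plain t → Plain (.tlam t)
  | tapp : ∀ {t S}, Plain t → Plain (.tapp t S)
  | shift : ∀ {t}, Plain t → Plain (.shift t)
  | reset : ∀ {t}, Plain t → Plain (.reset t)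
  | throwVar : ∀ {k t}, Plain t → Plain (.throwVar k t)

mutual
/-- Scoping predicate for terms: free term variables `< n`, free continuation
variables `< m`, free type variables `< p`. -/
inductive ScTm : Nat → Nat → Nat → Tm → Prop where
  | var : ∀ {n m p x}, x < n → ScTm n m p (.var x)
  | lam : ∀ {n m p S t}, ScopedTy p S → ScTm (n+1) m p t → ScTm n m p (.lam S t)
  | app : ∀ {n m p a b}, ScTm n m p a → ScTm n m p b → ScTm n m p (.app a b)
  | tlam : ∀ {n m p t}, ScTm n m (p+1) t → ScTm n m p (.tlam t)
  | tapp : ∀ {n m p t S}, ScTm n m p t → ScopedTy p S → ScTm n m p (.tapp t S)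
  | shift : ∀ {n m p t}, ScTm n (m+1) p t → ScTm n m p (.shift t)
  | reset : ∀ {n m p t}, ScTm n m p t → ScTm n m p (.reset t)
  | throwVar : ∀ {n m p k t}, k < m → ScTm n m p t → ScTm n m p (.throwVar k t)
  | throwCtx : ∀ {n m p E t}, ScCtx n m p E → ScTm n m p t → ScTm n m p (.throwCtx E t)

/-- Scoping predicate for contexts. -/
inductive ScCtx : Nat → Nat → Nat → Ctx → Prop where
  | hole : ∀ {n m p}, ScCtx n m p .hole
  | lamApp : ∀ {n m p S t E}, ScopedTy p S → ScTm (n+1) m p t → ScCtx n m p E →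
      ScCtx n m p (.lamApp S t E)
  | app : ∀ {n m p E t}, ScCtx n m p E → ScTm n m p t → ScCtx n m p (.app E t)
  | tapp : ∀ {n m p E S}, ScCtx n m p E → ScopedTy p S → ScCtx n m p (.tapp E S)
  | throw : ∀ {n m p E0 E1}, ScCtx n m p E0 → ScCtx n m p E1 → ScCtx n m p (.throw E0 E1)
end

/-- A closed term. -/
def ClosedTm (t : Tm) : Prop := ScTm 0 0 0 t

/-- A closed context. -/
def ClosedCtx (E : Ctx) : Prop := ScCtx 0 0 0 E

/-- A closed metacontext. -/
def ClosedMCtx (F : MCtx) : Prop := ∀ E ∈ F, ClosedCtx E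

mutual
/-- Renaming of the three kinds of variables in terms. -/
def renTm (ρx ρk ρa : Nat → Nat) : Tm → Tm
  | .var n => .var (ρx n)
  | .lam S t => .lam (renTy ρa S) (renTm (liftRen ρx) ρk ρa t)
  | .app a b => .app (renTm ρx ρk ρa a) (renTm ρx ρk ρa b)
  | .tlam t => .tlam (renTm ρx ρk (liftRen ρa) t)
  | .tapp t S => .tapp (renTm ρx ρk ρa t) (renTy ρa S)
  | .shift t => .shift (renTm ρx (liftRen ρk) ρa t)
  | .reset t => .reset (renTm ρx ρk ρa t)
  | .throwVar k t => .throwVar (ρk k) (renTm ρx ρk ρa t)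
  | .throwCtx E t => .throwCtx (renCtx ρx ρk ρa E) (renTm ρx ρk ρa t)

/-- Renaming of the three kinds of variables in contexts. -/
def renCtx (ρx ρk ρa : Nat → Nat) : Ctx → Ctx
  | .hole => .hole
  | .lamApp S t E => .lamApp (renTy ρa S) (renTm (liftRen ρx) ρk ρa t) (renCtx ρx ρk ρa E)
  | .app E t => .app (renCtx ρx ρk ρa E) (renTm ρx ρk ρa t)
  | .tapp E S => .tapp (renCtx ρx ρk ρa E) (renTy ρa S)
  | .throw E0 E => .throw (renCtx ρx ρk ρa E0) (renCtx ρx ρk ρa E)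
end

/-- Action of a context transformer on continuation-substitution entries. -/
def mapKEnt (f : Ctx → Ctx) : Ctx ⊕ Nat → Ctx ⊕ Nat
  | .inl E => .inl (f E)
  | .inr n => .inr n

/-- Lifting of a term substitution under a term binder. -/
def liftSubX (σ : Nat → Tm) : Nat → Tm
  | 0 => .var 0
  | n+1 => renTm Nat.succ id id (σ n)

/-- Shifting of a term substitution under a continuation binder. -/
def shiftSubXk (σ : Nat → Tm) : Nat → Tm := fun n => renTm id Nat.succ id (σ n)

/-- Shifting of a term substitution under a type binder. -/
def shiftSubXa (σ : Nat → Tm) : Nat → Tm := fun n => renTm id id Nat.succ (σ n)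

/-- Lifting of a continuation substitution under a continuation binder. -/
def liftSubK (σ : Nat → Ctx ⊕ Nat) : Nat → Ctx ⊕ Nat
  | 0 => .inr 0
  | n+1 =>
    match σ n with
    | .inl E => .inl (renCtx id Nat.succ id E)
    | .inr m => .inr (m+1)

/-- Shifting of a continuation substitution under a term binder. -/
def shiftSubKx (σ : Nat → Ctx ⊕ Nat) : Nat → Ctx ⊕ Nat :=
  fun n => mapKEnt (renCtx Nat.succ id id) (σ n)

/-- Shifting of a continuation substitution under a type binder. -/
def shiftSubKa (σ : Nat → Ctx ⊕ Nat) : Nat → Ctx ⊕ Nat :=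
  fun n => mapKEnt (renCtx id id Nat.succ) (σ n)

mutual
/-- Simultaneous capture-avoiding substitution in terms. -/
def subTm (σx : Nat → Tm) (σk : Nat → Ctx ⊕ Nat) (σa : Nat → Ty) : Tm → Tm
  | .var n => σx n
  | .lam S t => .lam (subTy σa S) (subTm (liftSubX σx) (shiftSubKx σk) σa t)
  | .app a b => .app (subTm σx σk σa a) (subTm σx σk σa b)
  | .tlam t => .tlam (subTm (shiftSubXa σx) (shiftSubKa σk) (liftTySub σa) t)
  | .tapp t S => .tapp (subTm σx σk σa t) (subTy σa S)
  | .shift t => .shift (subTm (shiftSubXk σx) (liftSubK σk) σa t)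
  | .reset t => .reset (subTm σx σk σa t)
  | .throwVar k t =>
    match σk k with
    | .inl E => .throwCtx E (subTm σx σk σa t)
    | .inr m => .throwVar m (subTm σx σk σa t)
  | .throwCtx E t => .throwCtx (subCtx σx σk σa E) (subTm σx σk σa t)

/-- Simultaneous capture-avoiding substitution in contexts. -/
def subCtx (σx : Nat → Tm) (σk : Nat → Ctx ⊕ Nat) (σa : Nat → Ty) : Ctx → Ctx
  | .hole => .hole
  | .lamApp S t E => .lamApp (subTy σa S) (subTm (liftSubX σx) (shiftSubKx σk) σa t) (subCtx σx σk σa E)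
  | .app E t => .app (subCtx σx σk σa E) (subTm σx σk σa t)
  | .tapp E S => .tapp (subCtx σx σk σa E) (subTy σa S)
  | .throw E0 E => .throw (subCtx σx σk σa E0) (subCtx σx σk σa E)
end

/-- `sub0X v t` is `t[x₀ := v]`. -/
def sub0X (v : Tm) (t : Tm) : Tm :=
  subTm (fun n => match n with | 0 => v | n+1 => .var n) Sum.inr Ty.var t

/-- `sub0A S t` is `t[α₀ := S]`. -/
def sub0A (S : Ty) (t : Tm) : Tm :=
  subTm Tm.var Sum.inr (fun n => match n with | 0 => S | n+1 => .var n) t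

/-- `sub0K E t` is `t[k₀ := ⌈E⌉]`. -/
def sub0K (E : Ctx) (t : Tm) : Tm :=
  subTm Tm.var (fun n => match n with | 0 => .inl E | n+1 => .inr n) Ty.var t

/-- `msub Vs vs Es t` is the simultaneous substitution
`t[ᾱ := Vs][x̄ := vs][k̄ := ⌈Es⌉]`. -/
def msub (Vs : List Ty) (vs : List Tm) (Es : List Ctx) (t : Tm) : Tm :=
  subTm (fun n => vs.getD n (.var n))
        (fun n => match Es[n]? with | some E => .inl E | none => .inr n)
        (fun n => Vs.getD n (.var n)) t

mutual
/-- The type system of Figure 2: typing of terms.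
`HasTy Γ Δ T t S U` encodes the judgment `Γ;Δ,T ⊢ t : S,U`, where `Γ` assigns
term types to term variables and `Δ` assigns context types `¬(S,T)`
(represented by the pair `(S,T)`) to continuation variables. -/
inductive HasTy : List Ty → List (Ty × Ty) → Ty → Tm → Ty → Ty → Prop where
  | var : ∀ {Γ Δ x S T}, Γ[x]? = some S → HasTy Γ Δ T (.var x) S T
  | lam : ∀ {Γ Δ S T U V W t}, HasTy (S::Γ) Δ U t T V →
      HasTy Γ Δ W (.lam S t) (.arrow S T U V) W
  | app : ∀ {Γ Δ S T U V W X t0 t1},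
      HasTy Γ Δ X t0 (.arrow S T U W) V → HasTy Γ Δ W t1 S X →
      HasTy Γ Δ U (.app t0 t1) T V
  | tlam : ∀ {Γ Δ S T U V t},
      HasTy (Γ.map (renTy Nat.succ)) (Δ.map (fun C => (renTy Nat.succ C.1, renTy Nat.succ C.2))) T t S U →
      HasTy Γ Δ V (.tlam t) (.all S T U) V
  | tapp : ∀ {Γ Δ S T U V W t},
      HasTy Γ Δ (subTy0 V U) t (.all S T U) W →
      HasTy Γ Δ (subTy0 V T) (.tapp t V) (subTy0 V S) W
  | reset : ∀ {Γ Δ S T U t}, HasTy Γ Δ U t U S → HasTy Γ Δ T (.reset t) S T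
  | shift : ∀ {Γ Δ S T U V t}, HasTy Γ ((S,T)::Δ) V t V U →
      HasTy Γ Δ T (.shift t) S U
  | throwVar : ∀ {Γ Δ k S T U V t}, Δ[k]? = some (S,T) → HasTy Γ Δ U t S V →
      HasTy Γ Δ U (.throwVar k t) T V
  | throwCtx : ∀ {Γ Δ E S T U V t}, HasTyCtx Γ Δ E S T → HasTy Γ Δ U t S V →
      HasTy Γ Δ U (.throwCtx E t) T V

/-- The type system of Figure 2: typing of contexts.
`HasTyCtx Γ Δ E S T` encodes `Γ;Δ ⊢ E : ¬(S,T)`. -/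
inductive HasTyCtx : List Ty → List (Ty × Ty) → Ctx → Ty → Ty → Prop where
  | hole : ∀ {Γ Δ S}, HasTyCtx Γ Δ .hole S S
  | app : ∀ {Γ Δ S T U V W t E},
      HasTyCtx Γ Δ E T U → HasTy Γ Δ V t S W →
      HasTyCtx Γ Δ (.app E t) (.arrow S T U V) W
  | lamApp : ∀ {Γ Δ S T U V W t E},
      HasTy Γ Δ W (.lam S t) (.arrow S T U V) W → HasTyCtx Γ Δ E T U →
      HasTyCtx Γ Δ (.lamApp S t E) S V
  | tapp : ∀ {Γ Δ S T U V E},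
      HasTyCtx Γ Δ E (subTy0 V S) (subTy0 V T) →
      HasTyCtx Γ Δ (.tapp E V) (.all S T U) (subTy0 V U)
  | throw : ∀ {Γ Δ S T U E' E},
      HasTyCtx Γ Δ E' S T → HasTyCtx Γ Δ E T U →
      HasTyCtx Γ Δ (.throw E' E) S U
end

/-- The type system of Figure 2: typing of metacontexts.
`HasTyMCtx Γ Δ F S` encodes `Γ;Δ ⊢ F : ¬¬S`. -/
inductive HasTyMCtx : List Ty → List (Ty × Ty) → MCtx → Ty → Prop where
  | nil : ∀ {Γ Δ S}, HasTyMCtx Γ Δ ([] : MCtx) S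
  | cons : ∀ {Γ Δ S T E F}, HasTyCtx Γ Δ E S T → HasTyMCtx Γ Δ F T →
      HasTyMCtx Γ Δ (E :: F : MCtx) S

/-- The call-by-value one-step reduction relation `→v` of `λF_{S,v}`.
Note that `plugm r (E::F)` is the program `F[⟨E[r]⟩]`. -/
inductive Step : Tm → Tm → Prop where
  | beta : ∀ {S t v E F}, IsValue v →
      Step (plugm (.app (.lam S t) v) (E::F)) (plugm (sub0X v t) (E::F))
  | betaT : ∀ {t S E F},
      Step (plugm (.tapp (.tlam t) S) (E::F)) (plugm (sub0A S t) (E::F))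
  | shift : ∀ {t E F},
      Step (plugm (.shift t) (E::F)) (plugm (.reset (sub0K E t)) F)
  | throw : ∀ {E' E F v}, IsValue v →
      Step (plugm (.throwCtx E' v) (E::F)) (plugm v (E'::E::F))
  | reset : ∀ {v E F}, IsValue v →
      Step (plugm (.reset v) (E::F)) (plugm v (E::F))

/-- Call-by-value evaluation: the reflexive-transitive closure of `→v`. -/
def Steps : Tm → Tm → Prop := Relation.ReflTransGen Step

/-- Redexes of `λF_{S,v}` under call by value. -/
inductive IsRedex : Tm → Prop where
  | beta : ∀ {S t v}, IsValue v → IsRedex (.app (.lam S t) v)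
  | betaT : ∀ {t S}, IsRedex (.tapp (.tlam t) S)
  | shift : ∀ {t}, IsRedex (.shift t)
  | throw : ∀ {E v}, IsValue v → IsRedex (.throwCtx E v)
  | reset : ∀ {v}, IsValue v → IsRedex (.reset v)

/-- `Norm p`: the program `p` evaluates to a value delimited by a reset. -/
def Norm (p : Tm) : Prop := ∃ v, IsValue v ∧ Steps p (.reset v)

/-- A reducibility candidate of type `S` is a set of closed values of type `S`. -/
def IsCand (S : Ty) (R : Set Tm) : Prop :=
  ∀ v ∈ R, IsValue v ∧ ClosedTm v ∧ ∀ W, HasTy [] [] W v S W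

/-- `MCtxOK R F` is the predicate `R ⊨⊨ F`, i.e. `∀ v ∈ R, norm (F[⟨v⟩])`. -/
def MCtxOK (R : Set Tm) (F : MCtx) : Prop := ∀ v ∈ R, Norm (plugm (.reset v) F)

/-- `MCtxAdm U R F`: `F` is a closed metacontext of type `¬¬U` with `R ⊨⊨ F`. -/
def MCtxAdm (U : Ty) (R : Set Tm) (F : MCtx) : Prop :=
  ClosedMCtx F ∧ HasTyMCtx [] [] F U ∧ MCtxOK R F

/-- `CtxOK T R R' E` is the predicate `(R,R') ⊨ E`:
`∀ v ∈ R, ∀ F, R' ⊨⊨ F → norm (F[⟨E[v]⟩])`, where `T` is the type of the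
candidate `R'` (so the metacontexts `F` range over closed metacontexts of
type `¬¬T`). -/
def CtxOK (T : Ty) (R R' : Set Tm) (E : Ctx) : Prop :=
  ∀ v ∈ R, ∀ F, MCtxAdm T R' F → Norm (plugm v (E::F))

/-- `CtxAdm S T R R' E`: `E` is a closed context of type `¬(S,T)` with `(R,R') ⊨ E`. -/
def CtxAdm (S T : Ty) (R R' : Set Tm) (E : Ctx) : Prop :=
  ClosedCtx E ∧ HasTyCtx [] [] E S T ∧ CtxOK T R R' E

/-- The parametric reducibility candidate `RED_S(ᾱ ↦ R̄)` for `λF_{S,v}`,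
defined by induction on `S`.  `Ts` are the types of the candidates `Rs`. -/
def RED : Ty → List Ty → List (Set Tm) → Set Tm
  | .var i, _, Rs => Rs.getD i ∅
  | .arrow S T U V, Ts, Rs =>
      {v0 | IsValue v0 ∧ ClosedTm v0 ∧ (∀ W, HasTy [] [] W v0 (subTyList Ts (.arrow S T U V)) W) ∧
        ∀ v1 ∈ RED S Ts Rs,
          ∀ E, CtxAdm (subTyList Ts T) (subTyList Ts U) (RED T Ts Rs) (RED U Ts Rs) E →
          ∀ F, MCtxAdm (subTyList Ts V) (RED V Ts Rs) F →
            Norm (plugm (.app v0 v1) (E::F))}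
  | .all S T U, Ts, Rs =>
      {v | IsValue v ∧ ClosedTm v ∧ (∀ W, HasTy [] [] W v (subTyList Ts (.all S T U)) W) ∧
        ∀ (V : Ty) (Rc : Set Tm), IsCand V Rc →
          ∀ E, CtxAdm (subTyList (V::Ts) S) (subTyList (V::Ts) T)
                 (RED S (V::Ts) (Rc::Rs)) (RED T (V::Ts) (Rc::Rs)) E →
          ∀ F, MCtxAdm (subTyList (V::Ts) U) (RED U (V::Ts) (Rc::Rs)) F →
            Norm (plugm (.tapp v V) (E::F))}

end LambdaFShift
namespace LambdaFShift

theorem renTy_eq_subTy (ρ : Nat → Nat) (S : Ty) :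
    renTy ρ S = subTy (fun n => .var (ρ n)) S := by
  have lift : ∀ ρ : Nat → Nat,
      liftTySub (fun n => .var (ρ n)) = fun n => .var (liftRen ρ n) := by
    intro ρ
    funext n
    cases n <;> rfl
  induction S generalizing ρ with
  | var n => rfl
  | arrow a b c d iha ihb ihc ihd => simp [renTy, subTy, iha, ihb, ihc, ihd]
  | all a b c iha ihb ihc => simp [renTy, subTy, iha, ihb, ihc, lift]

theorem subTy_renTy (σ : Nat → Ty) (ρ : Nat → Nat) (S : Ty) :
    subTy σ (renTy ρ S) = subTy (fun n => σ (ρ n)) S := by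
  have lift : ∀ (σ : Nat → Ty) (ρ : Nat → Nat),
      (fun n => liftTySub σ (liftRen ρ n)) = liftTySub (fun n => σ (ρ n)) := by
    intro σ ρ
    funext n
    cases n <;> rfl
  induction S generalizing σ ρ with
  | var n => rfl
  | arrow a b c d iha ihb ihc ihd => simp [renTy, subTy, iha, ihb, ihc, ihd]
  | all a b c iha ihb ihc => simp [renTy, subTy, iha, ihb, ihc, lift]

theorem renTy_renTy (ρ' ρ : Nat → Nat) (S : Ty) :
    renTy ρ' (renTy ρ S) = renTy (fun n => ρ' (ρ n)) S := by
  simp only [renTy_eq_subTy ρ', renTy_eq_subTy (fun n => ρ' (ρ n)), subTy_renTy]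

theorem renTy_subTy (ρ : Nat → Nat) (σ : Nat → Ty) (S : Ty) :
    renTy ρ (subTy σ S) = subTy (fun n => renTy ρ (σ n)) S := by
  have lift : ∀ (ρ : Nat → Nat) (σ : Nat → Ty),
      (fun n => renTy (liftRen ρ) (liftTySub σ n)) = liftTySub (fun n => renTy ρ (σ n)) := by
    intro ρ σ
    funext n
    cases n with
    | zero => rfl
    | succ n => simp only [liftTySub, renTy_renTy, liftRen]
  induction S generalizing σ ρ with
  | var n => rfl
  | arrow a b c d iha ihb ihc ihd => simp [renTy, subTy, iha, ihb, ihc, ihd]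
  | all a b c iha ihb ihc => simp [renTy, subTy, iha, ihb, ihc, lift]

theorem subTy_subTy (τ σ : Nat → Ty) (S : Ty) :
    subTy τ (subTy σ S) = subTy (fun n => subTy τ (σ n)) S := by
  have lift : ∀ τ σ : Nat → Ty,
      (fun n => subTy (liftTySub τ) (liftTySub σ n)) = liftTySub (fun n => subTy τ (σ n)) := by
    intro τ σ
    funext n
    cases n with
    | zero => rfl
    | succ n => simp only [liftTySub, subTy_renTy, renTy_subTy]
  induction S generalizing σ τ with
  | var n => rfl
  | arrow a b c d iha ihb ihc ihd => simp [subTy, iha, ihb, ihc, ihd]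
  | all a b c iha ihb ihc => simp [subTy, iha, ihb, ihc, lift]

theorem ScopedTy.subTy_congr {p : Nat} {S : Ty} (hS : ScopedTy p S) {σ τ : Nat → Ty}
    (h : ∀ i < p, σ i = τ i) : subTy σ S = subTy τ S := by
  induction hS generalizing σ τ with
  | var hn => exact h _ hn
  | arrow _ _ _ _ iha ihb ihc ihd => simp [subTy, iha h, ihb h, ihc h, ihd h]
  | @all p _ _ _ _ _ _ iha ihb ihc =>
    have h' : ∀ i < p + 1, liftTySub σ i = liftTySub τ i := by
      rintro (_ | i) hi
      · rfl
      · simp [liftTySub, h i (by omega)]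
    simp [subTy, iha h', ihb h', ihc h']

theorem ScopedTy.renTy {p q : Nat} {S : Ty} (hS : ScopedTy p S) {ρ : Nat → Nat}
    (h : ∀ i < p, ρ i < q) : ScopedTy q (renTy ρ S) := by
  induction hS generalizing ρ q with
  | var hn => exact .var (h _ hn)
  | arrow _ _ _ _ iha ihb ihc ihd => exact .arrow (iha h) (ihb h) (ihc h) (ihd h)
  | @all p _ _ _ _ _ _ iha ihb ihc =>
    have h' : ∀ i < p + 1, liftRen ρ i < q + 1 := by
      rintro (_ | i) hi
      · exact Nat.succ_pos q
      · exact Nat.succ_lt_succ (h i (by omega))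
    exact .all (iha h') (ihb h') (ihc h')

/-- Under a type substitution that agrees with the type assignments, closing types commutes with
substitution. -/
theorem ScopedTy.subTyList_subTy {p : Nat} {S : Ty} (hS : ScopedTy p S) {σ : Nat → Ty}
    {Ts Ts' : List Ty} (h : ∀ i < p, Ts[i]? = some (subTyList Ts' (σ i))) :
    subTyList Ts' (subTy σ S) = subTyList Ts S := by
  rw [subTyList, subTy_subTy]
  refine hS.subTy_congr fun i hi => ?_
  simp [h i hi, subTyList]

theorem ScopedTy.subTyList_renTy {p : Nat} {S : Ty} (hS : ScopedTy p S) {ρ : Nat → Nat}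
    {Ts Ts' : List Ty} (h : ∀ i < p, ∃ A, Ts[i]? = some A ∧ Ts'[ρ i]? = some A) :
    subTyList Ts' (LambdaFShift.renTy ρ S) = subTyList Ts S := by
  rw [renTy_eq_subTy]
  refine hS.subTyList_subTy fun i hi => ?_
  obtain ⟨A, h1, h2⟩ := h i hi
  simp [subTyList, subTy, h1, h2]

theorem ScopedTy.RED_renTy {p : Nat} {S : Ty} (hS : ScopedTy p S) {ρ : Nat → Nat}
    {Ts Ts' : List Ty} {Rs Rs' : List (Set Tm)}
    (hT : ∀ i < p, ∃ A, Ts[i]? = some A ∧ Ts'[ρ i]? = some A)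
    (hR : ∀ i < p, Rs'.getD (ρ i) ∅ = Rs.getD i ∅) :
    RED (LambdaFShift.renTy ρ S) Ts' Rs' = RED S Ts Rs := by
  induction hS generalizing ρ Ts Ts' Rs Rs' with
  | var hn => exact hR _ hn
  | arrow ha hb hc hd iha ihb ihc ihd =>
    have e := (ScopedTy.arrow ha hb hc hd).subTyList_renTy hT
    rw [LambdaFShift.renTy] at e ⊢
    simp only [RED, e, iha hT hR, ihb hT hR, ihc hT hR, ihd hT hR, hb.subTyList_renTy hT,
      hc.subTyList_renTy hT, hd.subTyList_renTy hT]
  | @all p _ _ _ ha hb hc iha ihb ihc =>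
    have e := (ScopedTy.all ha hb hc).subTyList_renTy hT
    have hT' (V : Ty) : ∀ i < p + 1, ∃ A, (V :: Ts)[i]? = some A ∧
        (V :: Ts')[liftRen ρ i]? = some A := by
      rintro (_ | i) hi
      · exact ⟨V, rfl, rfl⟩
      · simpa [liftRen] using hT i (by omega)
    have hR' (R : Set Tm) : ∀ i < p + 1,
        (R :: Rs').getD (liftRen ρ i) ∅ = (R :: Rs).getD i ∅ := by
      rintro (_ | i) hi
      · rfl
      · simpa [liftRen] using hR i (by omega)
    rw [LambdaFShift.renTy] at e ⊢
    simp only [RED, e, iha (hT' _) (hR' _), ihb (hT' _) (hR' _), ihc (hT' _) (hR' _),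
      ha.subTyList_renTy (hT' _), hb.subTyList_renTy (hT' _), hc.subTyList_renTy (hT' _)]

theorem ScopedTy.RED_subTy {p : Nat} {S : Ty} (hS : ScopedTy p S) {σ : Nat → Ty}
    {Ts Ts' : List Ty} {Rs Rs' : List (Set Tm)}
    (hσ : ∀ i < p, ScopedTy Ts'.length (σ i))
    (hT : ∀ i < p, Ts[i]? = some (subTyList Ts' (σ i)))
    (hR : ∀ i < p, RED (σ i) Ts' Rs' = Rs.getD i ∅) :
    RED (subTy σ S) Ts' Rs' = RED S Ts Rs := by
  induction hS generalizing σ Ts Ts' Rs Rs' with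
  | var hn => exact hR _ hn
  | arrow ha hb hc hd iha ihb ihc ihd =>
    have e := (ScopedTy.arrow ha hb hc hd).subTyList_subTy hT
    rw [subTy] at e ⊢
    simp only [RED, e, iha hσ hT hR, ihb hσ hT hR, ihc hσ hT hR, ihd hσ hT hR,
      hb.subTyList_subTy hT, hc.subTyList_subTy hT, hd.subTyList_subTy hT]
  | @all p _ _ _ ha hb hc iha ihb ihc =>
    have e := (ScopedTy.all ha hb hc).subTyList_subTy hT
    have weaken (V : Ty) : ∀ i < Ts'.length,
        ∃ A, Ts'[i]? = some A ∧ (V :: Ts')[Nat.succ i]? = some A :=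
      fun i hi => ⟨Ts'[i], by simp [hi]⟩
    have hσ' (V : Ty) : ∀ i < p + 1, ScopedTy (V :: Ts').length (liftTySub σ i) := by
      rintro (_ | i) hi
      · exact .var (Nat.succ_pos _)
      · exact (hσ i (by omega)).renTy fun j hj => Nat.succ_lt_succ hj
    have hT' (V : Ty) : ∀ i < p + 1,
        (V :: Ts)[i]? = some (subTyList (V :: Ts') (liftTySub σ i)) := by
      rintro (_ | i) hi
      · rfl
      · rw [liftTySub, (hσ i (by omega)).subTyList_renTy (weaken V)]
        exact hT i (by omega)
    have hR' (V : Ty) (R : Set Tm) : ∀ i < p + 1,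
        RED (liftTySub σ i) (V :: Ts') (R :: Rs') = (R :: Rs).getD i ∅ := by
      rintro (_ | i) hi
      · rfl
      · rw [liftTySub, (hσ i (by omega)).RED_renTy (weaken V) (Rs := Rs') fun j _ => rfl]
        exact hR i (by omega)
    rw [subTy] at e ⊢
    simp only [RED, e, iha (hσ' _) (hT' _) (hR' _ _), ihb (hσ' _) (hT' _) (hR' _ _),
      ihc (hσ' _) (hT' _) (hR' _ _), ha.subTyList_subTy (hT' _), hb.subTyList_subTy (hT' _),
      hc.subTyList_subTy (hT' _)]

/-- **Substitution lemma for parametric reducibility candidates in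
`λF_{S,v}`.**  The bound type variable `c` is represented by the de Bruijn
type variable `0`: for every type `S` with free type variables among `ᾱ, c`,
every type `T` with free type variables among `ᾱ`, every sequence of types
`Ts` interpreting `ᾱ`, and every sequence of reducibility candidates `Rs`
with `Rs i ∈ RC(Ts i)`, we have
`RED_{S[c:=T]}(ᾱ ↦ R̄) = RED_S(ᾱ, c ↦ R̄, RED_T(ᾱ ↦ R̄))`. -/
theorem RED_subst
    (S T : Ty) (Ts : List Ty) (Rs : List (Set Tm))
    (hS : ScopedTy (Ts.length + 1) S)
    (hT : ScopedTy Ts.length T)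
    (hlen : Ts.length = Rs.length)
    (hcand : ∀ i < Ts.length, IsCand (Ts.getD i (.var 0)) (Rs.getD i ∅)) :
    RED (subTy0 T S) Ts Rs = RED S (subTyList Ts T :: Ts) (RED T Ts Rs :: Rs) := by
  refine hS.RED_subTy ?_ ?_ ?_
  · rintro (_ | i) hi
    · exact hT
    · exact .var (by omega)
  · rintro (_ | i) hi
    · rfl
    · have hi' : i < Ts.length := by omega
      simp [subTyList, subTy, hi']
  · rintro (_ | i) hi <;> rfl

end LambdaFShift
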